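/- Let r ≥ 1 and φ : ℤ/rℤ → Σ_p(D), and suppose that V(φ(−i−1), φ(−i)) ≠ ∅ for every 0 ≤ i ≤ r−1. Then the map B_φ sending U = (u_d) ∈ M_{D,p}(φ) to the tuple of its base-p digits ((u_{d,i})_{d∈D})_{0≤i≤r−1}, where u_d = Σ_{i=0}^{r−1} p^i·u_{d,i} with 0 ≤ u_{d,i} ≤ p−1, is a bijection from M_{D,p}(φ) onto the product Π_{i=0}^{r−1} V(φ(−i−1), φ(−i)). Here M_{D,p}(φ) is the set of minimal elements U of E_{D,p}(r) with φ_U = φ. -/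

import Mathlib

open scoped BigOperators
open scoped Classical

/-- `sp p u` is the sum of the base-`p` digits of `u`. -/
def sp (p u : ℕ) : ℕ := (Nat.digits p u).sum

variable {ι : Type} [Fintype ι]

/-- The coordinatewise sum `Σ_{d ∈ D} u_d · d`. -/
def sigmaSum (D : Finset (ι → ℕ)) (U : D → ℕ) (k : ι) : ℕ :=
  ∑ d, U d * (d : ι → ℕ) k

/-- Membership in the set `E_{D,p}(r)`. -/
def memE (p : ℕ) (D : Finset (ι → ℕ)) (r : ℕ) (U : D → ℕ) : Prop :=
  (∀ d, U d ≤ p ^ r - 1) ∧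
  (∀ k, (p ^ r - 1) ∣ sigmaSum D U k ∧ 0 < sigmaSum D U k)

/-- The `p`-weight `s_p(U)` of a tuple `U`. -/
def spU (p : ℕ) (D : Finset (ι → ℕ)) (U : D → ℕ) : ℕ := ∑ d, sp p (U d)

/-- `s_{D,p}(r)`, the minimal `p`-weight of an element of `E_{D,p}(r)`. -/
noncomputable def sDp (p : ℕ) (D : Finset (ι → ℕ)) (r : ℕ) : ℕ :=
  sInf { s | ∃ U : D → ℕ, memE p D r U ∧ spU p D U = s }

/-- The `p`-density `δ_p(D)` of the set `D`. -/
noncomputable def density (p : ℕ) (D : Finset (ι → ℕ)) : ℝ :=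
  (1 / ((p : ℝ) - 1)) * sInf { x : ℝ | ∃ r : ℕ, 1 ≤ r ∧ x = (sDp p D r : ℝ) / (r : ℝ) }

/-- A minimal solution in `E_{D,p}(r)`. -/
def minimalSol (p : ℕ) (D : Finset (ι → ℕ)) (r : ℕ) (U : D → ℕ) : Prop :=
  memE p D r U ∧ (spU p D U : ℝ) = ((p : ℝ) - 1) * (r : ℝ) * density p D

/-- `φ_r(U) = (1/(p^r − 1)) Σ_{d ∈ D} u_d · d`. -/
def phiMap (p : ℕ) (D : Finset (ι → ℕ)) (r : ℕ) (U : D → ℕ) (k : ι) : ℕ :=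
  sigmaSum D U k / (p ^ r - 1)

/-- The shift `δ_r` on `{0, …, p^r − 1}`. -/
def shiftFun (p r u : ℕ) : ℕ := if u = p ^ r - 1 then u else (p * u) % (p ^ r - 1)

/-- The componentwise action of the shift `δ_r` on tuples. -/
def shiftE (p : ℕ) (D : Finset (ι → ℕ)) (r : ℕ) (U : D → ℕ) : D → ℕ :=
  fun d => shiftFun p r (U d)

/-- The support `φ_U : ℤ/rℤ → ℕ^n` of a solution `U ∈ E_{D,p}(r)`. -/
def suppMap (p : ℕ) (D : Finset (ι → ℕ)) (r : ℕ) (U : D → ℕ) (k : ZMod r) : ι → ℕ :=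
  phiMap p D r ((shiftE p D r)^[k.val] U)

/-- Membership in `MI_{D,p}(r)`: minimal irreducible solutions. -/
def memMI (p : ℕ) (D : Finset (ι → ℕ)) (r : ℕ) (U : D → ℕ) : Prop :=
  minimalSol p D r U ∧ Function.Injective (suppMap p D r U)

/-- The `p`-minimal support `Σ_p(D)`. -/
def minSupport (p : ℕ) (D : Finset (ι → ℕ)) : Set (ι → ℕ) :=
  { e | ∃ r : ℕ, 1 ≤ r ∧ ∃ U : D → ℕ, memMI p D r U ∧ e ∈ Set.range (suppMap p D r U) }

/-- `ψ(U)`: the tuple of last base-`p` digits of `U`. -/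
def psiMap (p : ℕ) (D : Finset (ι → ℕ)) (U : D → ℕ) : D → ℕ := fun d => U d % p

/-- The set `V(e, e')` of digit tuples of minimal irreducible solutions with
`φ_U(−1) = e` and `φ_U(0) = e'`. -/
def Vset (p : ℕ) (D : Finset (ι → ℕ)) (e e' : ι → ℕ) : Set (D → ℕ) :=
  { v | ∃ r : ℕ, 1 ≤ r ∧ ∃ U : D → ℕ, memMI p D r U ∧
      suppMap p D r U (-1) = e ∧ suppMap p D r U 0 = e' ∧ psiMap p D U = v }

/-- The weight `w(V) = Σ_{d ∈ D} v_d`. -/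
def weightV (D : Finset (ι → ℕ)) (v : D → ℕ) : ℕ := ∑ d, v d

/-! ### Digit lemmas -/

theorem aux_sum_digits (p u r : ℕ) :
    ∑ i ∈ Finset.range r, p ^ i * (u / p ^ i % p) = u % p ^ r := by
  induction r with
  | zero => simp [Nat.mod_one]
  | succ r ih => rw [Finset.sum_range_succ, ih, Nat.mod_pow_succ]

theorem aux_sp (p : ℕ) (hp : 2 ≤ p) (r : ℕ) : ∀ u, u < p ^ r →
    sp p u = ∑ i ∈ Finset.range r, u / p ^ i % p := by
  induction r with
  | zero => intro u hu; simp at hu; simp [sp, hu]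
  | succ r ih =>
    intro u hu
    rw [Finset.sum_range_succ']
    rcases Nat.eq_zero_or_pos u with h0 | h0
    · simp [sp, h0]
    · have h1 : u / p < p ^ r := by
        rw [Nat.div_lt_iff_lt_mul (by omega)]; rwa [pow_succ] at hu
      have h2 := ih _ h1
      unfold sp at h2 ⊢
      rw [Nat.digits_def' (by omega) h0, List.sum_cons, h2, add_comm]
      simp [Nat.div_div_eq_div_mul, pow_succ, mul_comm]

theorem aux_sum_lt (p : ℕ) (c : ℕ → ℕ) (r : ℕ) (hc : ∀ i < r, c i < p) :
    ∑ i ∈ Finset.range r, p ^ i * c i < p ^ r := by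
  induction r with
  | zero => simp
  | succ r ih =>
    rw [Finset.sum_range_succ, pow_succ]
    have h1 := ih (fun i hi => hc i (by omega))
    have h2 := hc r (by omega)
    have h3 : p ^ r * (c r + 1) ≤ p ^ r * p := Nat.mul_le_mul_left _ h2
    rw [mul_add, mul_one] at h3
    omega

theorem aux_digit (p : ℕ) (hp : 2 ≤ p) (c : ℕ → ℕ) (r : ℕ) (hc : ∀ i < r, c i < p) :
    ∀ i < r, (∑ i ∈ Finset.range r, p ^ i * c i) / p ^ i % p = c i := by
  induction r with
  | zero => intro i hi; omega
  | succ r ih =>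
    intro i hi
    have hS := aux_sum_lt p c r (fun i hi => hc i (by omega))
    rw [Finset.sum_range_succ]
    have hpi : 0 < p ^ i := by positivity
    rcases Nat.lt_or_ge i r with h | h
    · have h1 := ih (fun i hi => hc i (by omega)) i h
      obtain ⟨s, rfl⟩ : ∃ s, r = i + 1 + s := ⟨r - (i + 1), by omega⟩
      have h2 : p ^ (i + 1 + s) * c (i + 1 + s) = p ^ i * (p * (p ^ s * c (i + 1 + s))) := by ring
      rw [h2, Nat.add_mul_div_left _ _ hpi, Nat.add_mul_mod_self_left, h1]
    · have : i = r := by omega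
      subst this
      rw [Nat.add_mul_div_left _ _ hpi, Nat.div_eq_of_lt hS, zero_add,
        Nat.mod_eq_of_lt (hc i (by omega))]

theorem aux_shift (p r u : ℕ) (hp : 2 ≤ p) (hu : u ≤ p ^ (r + 1) - 1) :
    shiftFun p (r + 1) u = p * (u % p ^ r) + u / p ^ r := by
  have hq : 0 < p ^ r := by positivity
  have hm := Nat.div_add_mod u (p ^ r)
  have hlt := Nat.mod_lt u hq
  rw [shiftFun, pow_succ] at *
  generalize hQ : p ^ r = q at *
  generalize hA : u / q = a at *
  generalize hB : u % q = b at *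
  have hqp : 0 < q * p := by positivity
  have ha : a < p := by
    rw [← hA, Nat.div_lt_iff_lt_mul hq]
    rw [mul_comm p q]; omega
  split_ifs with h
  · have h1 : q * a + b + 1 = q * p := by omega
    have ha' : a + 1 = p := by
      by_contra hne
      have : q * (a + 2) ≤ q * p := Nat.mul_le_mul_left _ (by omega)
      have e : q * (a + 2) = q * a + q + q := by ring
      omega
    have hb' : b + 1 = q := by
      have : q * (a + 1) = q * a + q := by ring
      rw [ha'] at this
      omega
    rw [h]
    have : q * p = p * b + a + 1 := by rw [← hb']; nlinarith
    omega
  · have h1 : p * u = (p * b + a) + (q * p - 1) * a := by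
      obtain ⟨t, ht⟩ : ∃ t, q * p = t + 1 := ⟨q * p - 1, by omega⟩
      rw [ht, ← hm]
      simp only [Nat.add_sub_cancel]
      have : q * p * a = (t + 1) * a := by rw [ht]
      nlinarith
    rw [h1, Nat.add_mul_mod_self_left, Nat.mod_eq_of_lt]
    have h2 : q * a + b + 1 < q * p := by omega
    have h3 : p * b + p ≤ q * p := by
      have := Nat.mul_le_mul_left p hlt
      rw [Nat.succ_eq_add_one, mul_add, mul_one, mul_comm p q] at this
      exact this
    by_contra hcon
    have h4 : p * b + a + 1 ≥ q * p := by omega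
    have h5 : a + 1 = p := by omega
    have h6 : p * b + p = q * p := by omega
    have h7 : b + 1 = q := by
      have : p * (b + 1) = p * q := by rw [mul_add, mul_one, h6, mul_comm]
      exact Nat.eq_of_mul_eq_mul_left (by omega) this
    have : q * (a + 1) = q * a + q := by ring
    rw [h5] at this
    omega

theorem aux_shift_le (p r u : ℕ) (hp : 2 ≤ p) (hr : 1 ≤ r) (hu : u ≤ p ^ r - 1) :
    shiftFun p r u ≤ p ^ r - 1 := by
  have : p ^ 1 ≤ p ^ r := Nat.pow_le_pow_right (by omega) hr
  unfold shiftFun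
  split_ifs with h
  · exact hu
  · exact (Nat.mod_lt _ (by rw [pow_one] at this; omega)).le

theorem aux_shift_iter (p r u : ℕ) (hp : 2 ≤ p) (hr : 1 ≤ r) (hu : u ≤ p ^ r - 1) (j : ℕ)
    (hj : j ≤ r) :
    (shiftFun p r)^[j] u = p ^ j * (u % p ^ (r - j)) + u / p ^ (r - j) := by
  have hpr : 0 < p ^ r := by positivity
  induction j with
  | zero =>
    simp only [Function.iterate_zero, id, pow_zero, one_mul, Nat.sub_zero]
    rw [Nat.mod_eq_of_lt (by omega), Nat.div_eq_of_lt (by omega), add_zero]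
  | succ j ih =>
    rw [Function.iterate_succ_apply', ih (by omega)]
    obtain ⟨s, rfl⟩ : ∃ s, r = j + s + 1 := ⟨r - j - 1, by omega⟩
    have e1 : j + s + 1 - j = s + 1 := by omega
    have e2 : j + s + 1 - (j + 1) = s := by omega
    rw [e1, e2]
    have hA : u / p ^ (s + 1) < p ^ j := by
      rw [Nat.div_lt_iff_lt_mul (by positivity), ← pow_add]
      have : j + (s + 1) = j + s + 1 := by omega
      rw [this]; omega
    have hB : u % p ^ (s + 1) < p ^ (s + 1) := Nat.mod_lt _ (by positivity)
    have hC : u % p ^ (s + 1) = u % p ^ s + p ^ s * (u / p ^ s % p) := Nat.mod_pow_succ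
    have hE : u / p ^ s = p * (u / p ^ (s + 1)) + u / p ^ s % p := by
      rw [pow_succ, ← Nat.div_div_eq_div_mul, Nat.div_add_mod]
    have hB' : u % p ^ s < p ^ s := Nat.mod_lt _ (by positivity)
    have hlow : p ^ j * (u % p ^ s) + u / p ^ (s + 1) < p ^ (j + s) := by
      rw [pow_add p j s]
      have : p ^ j * (u % p ^ s + 1) ≤ p ^ j * p ^ s := Nat.mul_le_mul_left _ hB'
      rw [mul_add, mul_one] at this
      omega
    have key : p ^ j * (u % p ^ (s + 1)) + u / p ^ (s + 1) =
        (p ^ j * (u % p ^ s) + u / p ^ (s + 1)) + p ^ (j + s) * (u / p ^ s % p) := by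
      rw [hC, pow_add]; ring
    have hle : p ^ j * (u % p ^ (s + 1)) + u / p ^ (s + 1) ≤ p ^ (j + s + 1) - 1 := by
      have : p ^ j * (u % p ^ (s + 1) + 1) ≤ p ^ j * p ^ (s + 1) := Nat.mul_le_mul_left _ hB
      rw [mul_add, mul_one, ← pow_add, ← add_assoc] at this
      omega
    rw [aux_shift p (j + s) _ hp hle, key, Nat.add_mul_mod_self_left, Nat.mod_eq_of_lt hlow,
      Nat.add_mul_div_left _ _ (by positivity), Nat.div_eq_of_lt hlow]
    generalize u / p ^ s % p = y at *
    rw [hE, pow_succ]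
    ring

/-- Recursion for the iterated shift. -/
theorem aux_shift_rec (p r u : ℕ) (hp : 2 ≤ p) (hr : 1 ≤ r) (hu : u ≤ p ^ r - 1) (j : ℕ)
    (hj : j < r) :
    (shiftFun p r)^[j + 1] u + (p ^ r - 1) * (u / p ^ (r - 1 - j) % p)
      = p * (shiftFun p r)^[j] u := by
  rw [aux_shift_iter p r u hp hr hu j (by omega), aux_shift_iter p r u hp hr hu (j + 1) (by omega)]
  obtain ⟨s, rfl⟩ : ∃ s, r = j + s + 1 := ⟨r - j - 1, by omega⟩
  have e1 : j + s + 1 - j = s + 1 := by omega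
  have e2 : j + s + 1 - (j + 1) = s := by omega
  have e3 : j + s + 1 - 1 - j = s := by omega
  rw [e1, e2, e3]
  have hC : u % p ^ (s + 1) = u % p ^ s + p ^ s * (u / p ^ s % p) := Nat.mod_pow_succ
  have hE : u / p ^ s = p * (u / p ^ (s + 1)) + u / p ^ s % p := by
    rw [pow_succ, ← Nat.div_div_eq_div_mul, Nat.div_add_mod]
  generalize u / p ^ s % p = y at *
  rw [hE, hC]
  obtain ⟨t, ht⟩ : ∃ t, p ^ (j + s + 1) = t + 1 :=
    ⟨p ^ (j + s + 1) - 1, by have : 0 < p ^ (j + s + 1) := by positivity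
                             omega⟩
  have h2 : (t + 1) * y = p ^ j * p ^ s * p * y := by rw [← ht]; ring
  rw [ht, Nat.add_sub_cancel]
  have : p * (p ^ j * (u % p ^ s + p ^ s * y) + u / p ^ (s + 1))
    = p * p ^ j * (u % p ^ s) + p ^ j * p ^ s * p * y + p * (u / p ^ (s + 1)) := by ring
  rw [this, ← h2, pow_succ]
  ring

theorem aux_shift_period (p r u : ℕ) (hp : 2 ≤ p) (hr : 1 ≤ r) (hu : u ≤ p ^ r - 1) :
    (shiftFun p r)^[r] u = u := by
  rw [aux_shift_iter p r u hp hr hu r le_rfl]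
  simp [Nat.mod_one]

/-! ### Walks -/

/-- An edge of the digit graph. -/
def GEdge (p : ℕ) (D : Finset (ι → ℕ)) (a : ι → ℕ) (v : D → ℕ) (b : ι → ℕ) : Prop :=
  (∀ k, 0 < a k) ∧ (∀ d, v d < p) ∧ ∀ k, b k + sigmaSum D v k = p * a k

/-- Walks of given length and weight in the digit graph. -/
inductive Wk (p : ℕ) (D : Finset (ι → ℕ)) : ℕ → ℕ → (ι → ℕ) → (ι → ℕ) → Prop
  | nil (a : ι → ℕ) : Wk p D 0 0 a a
  | cons {n w : ℕ} {a b c : ι → ℕ} {v : D → ℕ} (h : GEdge p D a v b) (t : Wk p D n w b c) :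
      Wk p D (n + 1) (w + weightV D v) a c

theorem Wk.append {p : ℕ} {D : Finset (ι → ℕ)} {n w : ℕ} {a b : ι → ℕ} (h : Wk p D n w a b) :
    ∀ {m x : ℕ} {c : ι → ℕ}, Wk p D m x b c → Wk p D (n + m) (w + x) a c := by
  induction h with
  | nil a => intro m x c h; simpa using h
  | cons e t ih =>
    intro m x c h
    have := Wk.cons e (ih h)
    convert this using 1 <;> ring

theorem Wk.ofFun {p : ℕ} {D : Finset (ι → ℕ)} (f : ℕ → ι → ℕ) (v : ℕ → D → ℕ) (i n : ℕ)
    (h : ∀ j, i ≤ j → j < i + n → GEdge p D (f j) (v j) (f (j + 1))) :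
    Wk p D n (∑ j ∈ Finset.range n, weightV D (v (i + j))) (f i) (f (i + n)) := by
  induction n with
  | zero => simpa using Wk.nil (f i)
  | succ n ih =>
    have h1 := ih (fun j h1 h2 => h j h1 (by omega))
    have h2 := Wk.cons (h (i + n) (by omega) (by omega)) (Wk.nil _)
    have := h1.append h2
    rw [Finset.sum_range_succ]
    simpa [add_assoc] using this

theorem Wk.toFun {p : ℕ} {D : Finset (ι → ℕ)} {n w : ℕ} {a b : ι → ℕ} (h : Wk p D n w a b) :
    ∃ (f : ℕ → ι → ℕ) (v : ℕ → D → ℕ), f 0 = a ∧ f n = b ∧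
      (∀ j < n, GEdge p D (f j) (v j) (f (j + 1))) ∧
      ∑ j ∈ Finset.range n, weightV D (v j) = w := by
  induction h with
  | nil a => exact ⟨fun _ => a, fun _ _ => 0, rfl, rfl, by simp, by simp⟩
  | @cons n w a b c x e t ih =>
    obtain ⟨f, v, h0, hn, he, hw⟩ := ih
    refine ⟨fun j => Nat.casesOn j a f, fun j => Nat.casesOn j x v, rfl, hn, ?_, ?_⟩
    · intro j hj
      cases j with
      | zero => simpa [h0] using e
      | succ j => exact he j (by omega)
    · rw [Finset.sum_range_succ']
      simp [hw]

/-- The minimal mean weight. -/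
noncomputable def lam (p : ℕ) (D : Finset (ι → ℕ)) : ℝ :=
  sInf { x : ℝ | ∃ r : ℕ, 1 ≤ r ∧ x = (sDp p D r : ℝ) / (r : ℝ) }

theorem minimalSol_iff (p : ℕ) (hp : 2 ≤ p) (D : Finset (ι → ℕ)) (r : ℕ) (U : D → ℕ) :
    minimalSol p D r U ↔ memE p D r U ∧ (spU p D U : ℝ) = r * lam p D := by
  have : (p : ℝ) - 1 ≠ 0 := by
    have : (2 : ℝ) ≤ p := by exact_mod_cast hp
    linarith
  unfold minimalSol density lam
  have e : ∀ s : ℝ, ((p : ℝ) - 1) * r * (1 / ((p : ℝ) - 1) * s) = r * s := by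
    intro s; field_simp
  rw [e]

theorem shiftE_iter (p : ℕ) (D : Finset (ι → ℕ)) (r : ℕ) (U : D → ℕ) (j : ℕ) (d : D) :
    (shiftE p D r)^[j] U d = (shiftFun p r)^[j] (U d) := by
  induction j with
  | zero => rfl
  | succ j ih => rw [Function.iterate_succ_apply', Function.iterate_succ_apply', ← ih]; rfl

theorem sigmaSum_rec (p : ℕ) (hp : 2 ≤ p) (D : Finset (ι → ℕ)) (r : ℕ) (hr : 1 ≤ r) (U : D → ℕ)
    (hU : ∀ d, U d ≤ p ^ r - 1) (j : ℕ) (hj : j < r) (k : ι) :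
    sigmaSum D ((shiftE p D r)^[j + 1] U) k
      + (p ^ r - 1) * sigmaSum D (fun d => U d / p ^ (r - 1 - j) % p) k
      = p * sigmaSum D ((shiftE p D r)^[j] U) k := by
  unfold sigmaSum
  rw [Finset.mul_sum, Finset.mul_sum, ← Finset.sum_add_distrib]
  refine Finset.sum_congr rfl fun d _ => ?_
  rw [shiftE_iter, shiftE_iter, ← mul_assoc p, ← aux_shift_rec p r (U d) hp hr (hU d) j hj]
  ring

theorem pow_sub_pos (p : ℕ) (hp : 2 ≤ p) (r : ℕ) (hr : 1 ≤ r) : 0 < p ^ r - 1 := by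
  have : p ^ 1 ≤ p ^ r := Nat.pow_le_pow_right (by omega) hr
  rw [pow_one] at this
  omega

theorem memE_dvd (p : ℕ) (hp : 2 ≤ p) (D : Finset (ι → ℕ)) (r : ℕ) (hr : 1 ≤ r) (U : D → ℕ)
    (hU : memE p D r U) (j : ℕ) (hj : j ≤ r) (k : ι) :
    (p ^ r - 1) ∣ sigmaSum D ((shiftE p D r)^[j] U) k ∧
      0 < sigmaSum D ((shiftE p D r)^[j] U) k := by
  induction j with
  | zero => exact hU.2 k
  | succ j ih =>
    have ih := ih (by omega)
    have h := sigmaSum_rec p hp D r hr U hU.1 j (by omega) k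
    refine ⟨?_, ?_⟩
    · have h1 : (p ^ r - 1) ∣ p * sigmaSum D ((shiftE p D r)^[j] U) k := ih.1.mul_left p
      rw [← h] at h1
      exact (Nat.dvd_add_left (Dvd.intro _ rfl)).1 h1
    · obtain ⟨d, -, hd⟩ := Finset.exists_ne_zero_of_sum_ne_zero ih.2.ne'
      have hd1 : (shiftE p D r)^[j] U d ≠ 0 := left_ne_zero_of_mul hd
      have hd2 := right_ne_zero_of_mul hd
      refine Finset.sum_pos' (fun _ _ => Nat.zero_le _) ⟨d, Finset.mem_univ _, ?_⟩
      refine Nat.mul_pos (Nat.pos_of_ne_zero ?_) (Nat.pos_of_ne_zero hd2)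
      rw [shiftE_iter] at hd1 ⊢
      intro h0
      apply hd1
      have hz : ∀ m, (shiftFun p r)^[m] 0 = 0 := by
        intro m
        induction m with
        | zero => rfl
        | succ m ih => rw [Function.iterate_succ_apply', ih]; simp [shiftFun]
      have hper := aux_shift_period p r (U d) hp hr (hU.1 d)
      have : r = (r - (j + 1)) + (j + 1) := by omega
      have h2 : U d = 0 := by
        rw [← hper, this, Function.iterate_add_apply, ← this, h0, hz]
      rw [h2, hz]

theorem edge_of_memE (p : ℕ) (hp : 2 ≤ p) (D : Finset (ι → ℕ)) (r : ℕ) (hr : 1 ≤ r) (U : D → ℕ)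
    (hU : memE p D r U) (j : ℕ) (hj : j < r) :
    GEdge p D (phiMap p D r ((shiftE p D r)^[j] U)) (fun d => U d / p ^ (r - 1 - j) % p)
      (phiMap p D r ((shiftE p D r)^[j + 1] U)) := by
  have hP := pow_sub_pos p hp r hr
  refine ⟨fun k => ?_, fun d => Nat.mod_lt _ (by omega), fun k => ?_⟩
  · obtain ⟨h1, h2⟩ := memE_dvd p hp D r hr U hU j (by omega) k
    exact Nat.div_pos (Nat.le_of_dvd h2 h1) hP
  · have h := sigmaSum_rec p hp D r hr U hU.1 j hj k
    obtain ⟨h1, -⟩ := memE_dvd p hp D r hr U hU j (by omega) k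
    obtain ⟨h2, -⟩ := memE_dvd p hp D r hr U hU (j + 1) (by omega) k
    unfold phiMap
    obtain ⟨x, hx⟩ := h1
    obtain ⟨y, hy⟩ := h2
    rw [hx, hy] at h
    rw [hx, hy, Nat.mul_div_cancel_left _ hP, Nat.mul_div_cancel_left _ hP]
    apply Nat.eq_of_mul_eq_mul_left hP
    rw [mul_add, h]; ring

theorem shiftE_period (p : ℕ) (hp : 2 ≤ p) (D : Finset (ι → ℕ)) (r : ℕ) (hr : 1 ≤ r) (U : D → ℕ)
    (hU : ∀ d, U d ≤ p ^ r - 1) : (shiftE p D r)^[r] U = U := by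
  funext d
  rw [shiftE_iter, aux_shift_period p r _ hp hr (hU d)]

theorem spU_eq (p : ℕ) (hp : 2 ≤ p) (D : Finset (ι → ℕ)) (r : ℕ) (hr : 1 ≤ r) (U : D → ℕ)
    (hU : ∀ d, U d ≤ p ^ r - 1) :
    spU p D U = ∑ j ∈ Finset.range r, weightV D (fun d => U d / p ^ (r - 1 - j) % p) := by
  have hP := pow_sub_pos p hp r hr
  rw [Finset.sum_range_reflect (fun i => weightV D (fun d => U d / p ^ i % p))]
  unfold spU weightV
  rw [Finset.sum_comm]
  exact Finset.sum_congr rfl fun d _ => aux_sp p hp r _ (by have := hU d; omega)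

theorem suppMap_cast (p : ℕ) (hp : 2 ≤ p) (D : Finset (ι → ℕ)) (r : ℕ) (hr : 1 ≤ r) (U : D → ℕ)
    (hU : ∀ d, U d ≤ p ^ r - 1) (j : ℕ) (hj : j ≤ r) :
    suppMap p D r U (j : ZMod r) = phiMap p D r ((shiftE p D r)^[j] U) := by
  unfold suppMap
  rw [ZMod.val_natCast]
  rcases Nat.lt_or_ge j r with h | h
  · rw [Nat.mod_eq_of_lt h]
  · have : j = r := by omega
    subst this
    rw [Nat.mod_self, shiftE_period p hp D j hr U hU]; rfl

/-- From a closed walk to a solution. -/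
theorem sol_of_walk (p : ℕ) (hp : 2 ≤ p) (D : Finset (ι → ℕ)) (n : ℕ) (hn : 1 ≤ n)
    (f : ℕ → ι → ℕ) (v : ℕ → D → ℕ) (he : ∀ j < n, GEdge p D (f j) (v j) (f (j + 1)))
    (hc : f n = f 0) :
    ∃ U : D → ℕ, memE p D n U ∧ (∀ i < n, ∀ d, U d / p ^ i % p = v (n - 1 - i) d) ∧
      spU p D U = ∑ j ∈ Finset.range n, weightV D (v j) ∧
      ∀ j ≤ n, suppMap p D n U (j : ZMod n) = f j := by
  have hP := pow_sub_pos p hp n hn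
  set U : D → ℕ := fun d => ∑ i ∈ Finset.range n, p ^ i * v (n - 1 - i) d with hUdef
  have hle : ∀ d, U d ≤ p ^ n - 1 := by
    intro d
    have := aux_sum_lt p (fun i => v (n - 1 - i) d) n
      (fun i hi => (he (n - 1 - i) (by omega)).2.1 d)
    have h2 : U d < p ^ n := this
    omega
  have hdig : ∀ i < n, ∀ d, U d / p ^ i % p = v (n - 1 - i) d := by
    intro i hi d
    exact aux_digit p hp (fun i => v (n - 1 - i) d) n
      (fun i hi => (he (n - 1 - i) (by omega)).2.1 d) i hi
  have htel : ∀ m ≤ n, ∀ k,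
      sigmaSum D (fun d => ∑ i ∈ Finset.range m, p ^ i * v (n - 1 - i) d) k + f n k
        = p ^ m * f (n - m) k := by
    intro m
    induction m with
    | zero => intro _ k; simp [sigmaSum]
    | succ m ih =>
      intro hm k
      have h1 := ih (by omega) k
      have h2 := (he (n - 1 - m) (by omega)).2.2 k
      have e1 : n - 1 - m + 1 = n - m := by omega
      have e2 : n - (m + 1) = n - 1 - m := by omega
      rw [e1] at h2
      rw [e2, pow_succ, mul_assoc, ← h2, mul_add, ← h1]
      have : sigmaSum D (fun d => ∑ i ∈ Finset.range (m + 1), p ^ i * v (n - 1 - i) d) k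
          = sigmaSum D (fun d => ∑ i ∈ Finset.range m, p ^ i * v (n - 1 - i) d) k
            + p ^ m * sigmaSum D (v (n - 1 - m)) k := by
        unfold sigmaSum
        rw [Finset.mul_sum, ← Finset.sum_add_distrib]
        refine Finset.sum_congr rfl fun d _ => ?_
        simp only [Finset.sum_range_succ]; ring
      rw [this]; ring
  have hsig : ∀ k, sigmaSum D U k = (p ^ n - 1) * f 0 k := by
    intro k
    have h := htel n le_rfl k
    rw [Nat.sub_self, hc] at h
    rw [Nat.sub_mul, one_mul, ← h, Nat.add_sub_cancel]
  have hE : memE p D n U := by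
    refine ⟨hle, fun k => ?_⟩
    rw [hsig]
    exact ⟨Dvd.intro _ rfl, Nat.mul_pos hP ((he 0 (by omega)).1 k)⟩
  refine ⟨U, hE, hdig, ?_, ?_⟩
  · rw [spU_eq p hp D n hn U hle]
    refine Finset.sum_congr rfl fun j hj => ?_
    rw [Finset.mem_range] at hj
    congr 1
    funext d
    rw [hdig _ (by omega)]
    congr 2; omega
  · intro j hj
    rw [suppMap_cast p hp D n hn U hle j hj]
    induction j with
    | zero =>
      funext k
      simp only [Function.iterate_zero, id, phiMap]
      rw [hsig, Nat.mul_div_cancel_left _ hP]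
    | succ j ih =>
      have ih := ih (by omega)
      have h1 := edge_of_memE p hp D n hn U hE j (by omega)
      have h2 := he j (by omega)
      have h3 : (fun d => U d / p ^ (n - 1 - j) % p) = v j := by
        funext d
        rw [hdig _ (by omega)]
        congr 2; omega
      rw [ih, h3] at h1
      funext k
      have a1 := h1.2.2 k
      have a2 := h2.2.2 k
      omega

theorem lower_bound (p : ℕ) (hp : 2 ≤ p) (D : Finset (ι → ℕ)) {n w : ℕ} {a : ι → ℕ}
    (h : Wk p D n w a a) : (n : ℝ) * lam p D ≤ w := by
  rcases Nat.eq_zero_or_pos n with h0 | h0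
  · subst h0; simp
  · obtain ⟨f, v, hf0, hfn, he, hw⟩ := h.toFun
    obtain ⟨U, hE, -, hs, -⟩ := sol_of_walk p hp D n h0 f v he (hfn.trans hf0.symm)
    have h1 : sDp p D n ≤ w := Nat.sInf_le ⟨U, hE, hs.trans hw⟩
    have h2 : lam p D ≤ (sDp p D n : ℝ) / n := by
      refine csInf_le ⟨0, ?_⟩ ⟨n, h0, rfl⟩
      rintro x ⟨r, -, rfl⟩
      positivity
    have hn : (0 : ℝ) < n := by exact_mod_cast h0
    have h3 : (sDp p D n : ℝ) ≤ w := by exact_mod_cast h1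
    rw [le_div_iff₀ hn] at h2
    linarith

/-- Edges lying on a closed walk of minimal mean weight belong to `Vset`. -/
theorem mem_Vset_of_walk (p : ℕ) (hp : 2 ≤ p) (D : Finset (ι → ℕ)) (n : ℕ) :
    ∀ (w : ℕ) (a b : ι → ℕ) (x : D → ℕ), GEdge p D a x b → Wk p D n w b a →
      ((w + weightV D x : ℕ) : ℝ) = ((n + 1 : ℕ) : ℝ) * lam p D → x ∈ Vset p D a b := by
  induction n using Nat.strong_induction_on with
  | _ n IH =>
  intro w a b x hx hW hmin
  obtain ⟨f, v, hf0, hfn, he, hw⟩ := hW.toFun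
  by_cases hinj : ∀ i j, i < j → j ≤ n → f i ≠ f j
  · obtain ⟨U, hE, hdig, hs, hsup⟩ := sol_of_walk p hp D (n + 1) (by omega)
      (fun j => if j = n + 1 then b else f j) (fun j => if j = n then x else v j)
      (by
        intro j hj
        rcases Nat.lt_or_ge j n with h | h
        · have := he j h
          simpa [show j ≠ n + 1 by omega, show j ≠ n by omega] using this
        · have : j = n := by omega
          subst this
          simpa [hfn] using hx)
      (by simp [hf0])
    refine ⟨n + 1, by omega, U, ⟨?_, ?_⟩, ?_, ?_, ?_⟩
    · rw [minimalSol_iff p hp]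
      refine ⟨hE, ?_⟩
      rw [← hmin, hs, Finset.sum_range_succ, ← hw]
      congr 2
      · refine Finset.sum_congr rfl fun j hj => ?_
        rw [Finset.mem_range] at hj
        rw [if_neg (by omega)]
      · simp
    · intro s t hst
      have hs1 := ZMod.val_lt s
      have ht1 := ZMod.val_lt t
      rw [← ZMod.natCast_zmod_val s, ← ZMod.natCast_zmod_val t, hsup _ hs1.le, hsup _ ht1.le] at hst
      simp only [show s.val ≠ n + 1 by omega, show t.val ≠ n + 1 by omega, if_false] at hst
      apply ZMod.val_injective
      rcases lt_trichotomy s.val t.val with h | h | h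
      · exact absurd hst (hinj _ _ h (by omega))
      · exact h
      · exact absurd hst.symm (hinj _ _ h (by omega))
    · have : (-1 : ZMod (n + 1)) = (n : ZMod (n + 1)) := by
        have h : ((n + 1 : ℕ) : ZMod (n + 1)) = 0 := ZMod.natCast_self _
        push_cast at h
        exact (eq_neg_of_add_eq_zero_left h).symm
      rw [this, hsup n (by omega)]
      simp [hfn]
    · have := hsup 0 (by omega)
      simpa [hf0] using this
    · funext d
      have := hdig 0 (by omega) d
      simpa [psiMap] using this
  · push Not at hinj
    obtain ⟨i, j, hij, hjn, hfij⟩ := hinj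
    have w1 := Wk.ofFun f v 0 i (fun m _ h => he m (by omega))
    have w2 := Wk.ofFun f v i (j - i) (fun m _ h => he m (by omega))
    have w3 := Wk.ofFun f v j (n - j) (fun m _ h => he m (by omega))
    rw [zero_add, hf0] at w1
    rw [show i + (j - i) = j by omega, ← hfij] at w2
    rw [show j + (n - j) = n by omega, hfn, ← hfij] at w3
    have hsum : ∑ m ∈ Finset.range i, weightV D (v (0 + m)) +
        ∑ m ∈ Finset.range (j - i), weightV D (v (i + m)) +
        ∑ m ∈ Finset.range (n - j), weightV D (v (j + m)) = w := by
      rw [← hw]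
      conv_rhs => rw [show n = i + (j - i) + (n - j) by omega]
      rw [Finset.sum_range_add, Finset.sum_range_add]
      simp only [zero_add]
      rw [show i + (j - i) = j by omega]
    generalize ∑ m ∈ Finset.range i, weightV D (v (0 + m)) = x1 at *
    generalize ∑ m ∈ Finset.range (j - i), weightV D (v (i + m)) = x2 at *
    generalize ∑ m ∈ Finset.range (n - j), weightV D (v (j + m)) = x3 at *
    have w13 := w1.append w3
    have b2 := lower_bound p hp D w2
    have b13 := lower_bound p hp D (Wk.cons hx w13)
    refine IH (i + (n - j)) (by omega) _ a b x hx w13 ?_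
    obtain ⟨s, rfl⟩ : ∃ s, j = i + s := ⟨j - i, by omega⟩
    obtain ⟨t, rfl⟩ : ∃ t, n = i + s + t := ⟨n - (i + s), by omega⟩
    rw [show i + s - i = s by omega] at *
    rw [show i + s + t - (i + s) = t by omega] at *
    subst hsum
    push_cast at *
    linarith

/-- Conversely, elements of `Vset` lie on a closed walk of minimal mean weight. -/
theorem walk_of_mem_Vset (p : ℕ) (hp : 2 ≤ p) (D : Finset (ι → ℕ)) (a b : ι → ℕ) (x : D → ℕ)
    (hx : x ∈ Vset p D a b) : GEdge p D a x b ∧ ∃ n w : ℕ, Wk p D n w b a ∧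
      ((w + weightV D x : ℕ) : ℝ) = ((n + 1 : ℕ) : ℝ) * lam p D := by
  obtain ⟨r, hr, U, ⟨hm, -⟩, h1, h2, h3⟩ := hx
  rw [minimalSol_iff p hp] at hm
  obtain ⟨hE, hm⟩ := hm
  obtain ⟨n, rfl⟩ : ∃ n, r = n + 1 := ⟨r - 1, by omega⟩
  have hneg : (-1 : ZMod (n + 1)) = (n : ZMod (n + 1)) := by
    have h : ((n + 1 : ℕ) : ZMod (n + 1)) = 0 := ZMod.natCast_self _
    push_cast at h
    exact (eq_neg_of_add_eq_zero_left h).symm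
  rw [hneg, suppMap_cast p hp D _ hr U hE.1 n (by omega)] at h1
  have h0 := suppMap_cast p hp D _ hr U hE.1 0 (by omega)
  rw [Nat.cast_zero, h2] at h0
  have hl := edge_of_memE p hp D _ hr U hE n (by omega)
  have hdig : (fun d => U d / p ^ (n + 1 - 1 - n) % p) = x := by
    rw [← h3]; funext d; simp [psiMap]
  rw [h1, shiftE_period p hp D _ hr U hE.1, hdig] at hl
  have hb : phiMap p D (n + 1) U = b := h0.symm
  rw [hb] at hl
  refine ⟨hl, n, ∑ j ∈ Finset.range n, weightV D (fun d => U d / p ^ (n + 1 - 1 - j) % p),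
    ?_, ?_⟩
  · have := Wk.ofFun (fun j => phiMap p D (n + 1) ((shiftE p D (n + 1))^[j] U))
      (fun j d => U d / p ^ (n + 1 - 1 - j) % p) 0 n
      (fun j _ hj => edge_of_memE p hp D _ hr U hE j (by omega))
    simp only [zero_add] at this
    rw [h1, ← h0] at this
    exact this
  · rw [← hm, spU_eq p hp D _ hr U hE.1, Finset.sum_range_succ, hdig]

/-- If all the sets `V(φ(−i−1), φ(−i))` are nonempty, the base-`p` digit map `B_φ`
is a bijection from `M_{D,p}(φ)` onto `Π_{i=0}^{r−1} V(φ(−i−1), φ(−i))`. -/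
theorem digit_map_bijOn (p : ℕ) (hp : p.Prime) {ι : Type} [Fintype ι] [Nonempty ι]
    (D : Finset (ι → ℕ)) (hD : D.Nonempty)
    (hcoord : ∀ k : ι, ∃ d ∈ D, 0 < d k)
    (r : ℕ) (hr : 1 ≤ r) (φ : ZMod r → (ι → ℕ))
    (hφ : ∀ i, φ i ∈ minSupport p D)
    (hne : ∀ i : ℕ, i < r →
      (Vset p D (φ (-(i : ZMod r) - 1)) (φ (-(i : ZMod r)))).Nonempty) :
    Set.BijOn (fun (U : D → ℕ) (i : Fin r) (d : D) => U d / p ^ (i : ℕ) % p)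
      { U : D → ℕ | minimalSol p D r U ∧ suppMap p D r U = φ }
      { g : Fin r → (D → ℕ) | ∀ i : Fin r,
          g i ∈ Vset p D (φ (-((i : ℕ) : ZMod r) - 1)) (φ (-((i : ℕ) : ZMod r))) } := by
  have hp2 : 2 ≤ p := hp.two_le
  have hP := pow_sub_pos p hp2 r hr
  have hi1 : ∀ i : ℕ, i < r → (-(i : ZMod r) - 1) = ((r - 1 - i : ℕ) : ZMod r) := by
    intro i hi
    have h : ((r - 1 - i + i + 1 : ℕ) : ZMod r) = 0 := by
      rw [show r - 1 - i + i + 1 = r by omega]; exact ZMod.natCast_self _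
    rw [Nat.cast_add, Nat.cast_add, Nat.cast_one] at h
    linear_combination -h
  have hi2 : ∀ i : ℕ, i < r → (-(i : ZMod r)) = ((r - 1 - i + 1 : ℕ) : ZMod r) := by
    intro i hi
    have h : ((r - 1 - i + 1 + i : ℕ) : ZMod r) = 0 := by
      rw [show r - 1 - i + 1 + i = r by omega]; exact ZMod.natCast_self _
    rw [Nat.cast_add] at h
    linear_combination -h
  refine ⟨?_, ?_, ?_⟩
  · rintro U ⟨hm, hs⟩ ⟨i, hi⟩
    rw [minimalSol_iff p hp2] at hm
    obtain ⟨hE, hm⟩ := hm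
    obtain ⟨j, hj⟩ : ∃ j, j = r - 1 - i := ⟨_, rfl⟩
    have hij : i = r - 1 - j := by omega
    simp only
    rw [hi1 i hi, hi2 i hi, ← hj, ← hs, suppMap_cast p hp2 D r hr U hE.1 j (by omega),
      suppMap_cast p hp2 D r hr U hE.1 (j + 1) (by omega), hij]
    have hed := edge_of_memE p hp2 D r hr U hE
    have w1 := Wk.ofFun (fun j => phiMap p D r ((shiftE p D r)^[j] U))
      (fun j d => U d / p ^ (r - 1 - j) % p) 0 j (fun m _ h => hed m (by omega))
    have w2 := Wk.ofFun (fun j => phiMap p D r ((shiftE p D r)^[j] U))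
      (fun j d => U d / p ^ (r - 1 - j) % p) (j + 1) (r - (j + 1))
      (fun m _ h => hed m (by omega))
    simp only [zero_add] at w1
    simp only [show j + 1 + (r - (j + 1)) = r by omega] at w2
    rw [shiftE_period p hp2 D r hr U hE.1] at w2
    have w := w2.append w1
    refine mem_Vset_of_walk p hp2 D _ _ _ _ _ (hed j (by omega)) w ?_
    have hr' : r - (j + 1) + j + 1 = r := by omega
    rw [hr', ← hm, spU_eq p hp2 D r hr U hE.1]
    conv_rhs => rw [show r = j + 1 + (r - (j + 1)) by omega]
    rw [Finset.sum_range_add, Finset.sum_range_succ]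
    simp only [show j + 1 + (r - (j + 1)) = r by omega]
    congr 1
    ring
  · rintro U ⟨hm, -⟩ U' ⟨hm', -⟩ h
    funext d
    have h1 := hm.1.1 d
    have h2 := hm'.1.1 d
    rw [← Nat.mod_eq_of_lt (show U d < p ^ r by omega),
      ← Nat.mod_eq_of_lt (show U' d < p ^ r by omega), ← aux_sum_digits, ← aux_sum_digits]
    refine Finset.sum_congr rfl fun i hi => ?_
    have := congrFun (congrFun h ⟨i, Finset.mem_range.1 hi⟩) d
    simp only at this
    rw [this]
  · intro g hg
    set f : ℕ → ι → ℕ := fun j => φ (j : ZMod r) with hf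
    set v : ℕ → D → ℕ := fun j => if h : r - 1 - j < r then g ⟨r - 1 - j, h⟩ else 0 with hv
    have hmem : ∀ j < r, v j ∈ Vset p D (f j) (f (j + 1)) := by
      intro j hj
      have hlt : r - 1 - j < r := by omega
      have h := hg ⟨r - 1 - j, hlt⟩
      simp only at h
      rw [hi1 _ hlt, hi2 _ hlt, show r - 1 - (r - 1 - j) = j by omega] at h
      simpa [hv, hf, hlt] using h
    have hedge : ∀ j < r, GEdge p D (f j) (v j) (f (j + 1)) := fun j hj =>
      (walk_of_mem_Vset p hp2 D _ _ _ (hmem j hj)).1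
    have hclosed : f r = f 0 := by simp [hf]
    obtain ⟨U, hE, hdig, hs, hsup⟩ := sol_of_walk p hp2 D r hr f v hedge hclosed
    have hW := Wk.ofFun f v 0 r (fun j _ h => hedge j (by omega))
    rw [zero_add, hclosed] at hW
    simp only [zero_add] at hW
    have hlow := lower_bound p hp2 D hW
    have hrev : ∀ m ≤ r, ∃ N W : ℕ, Wk p D N W (f m) (f 0) ∧
        ((W + ∑ j ∈ Finset.range m, weightV D (v j) : ℕ) : ℝ) = ((N + m : ℕ) : ℝ) * lam p D := by
      intro m
      induction m with
      | zero => exact fun _ => ⟨0, 0, Wk.nil _, by simp⟩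
      | succ m ih =>
        intro hm
        obtain ⟨N, W, h1, h2⟩ := ih (by omega)
        obtain ⟨-, n, w, h3, h4⟩ := walk_of_mem_Vset p hp2 D _ _ _ (hmem m (by omega))
        refine ⟨n + N, w + W, h3.append h1, ?_⟩
        rw [Finset.sum_range_succ]
        push_cast at *
        linarith
    obtain ⟨N, W, h1, h2⟩ := hrev r le_rfl
    rw [hclosed] at h1
    have hlow2 := lower_bound p hp2 D h1
    refine ⟨U, ⟨?_, ?_⟩, ?_⟩
    · rw [minimalSol_iff p hp2]
      refine ⟨hE, ?_⟩
      rw [hs]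
      push_cast at *
      linarith
    · haveI : NeZero r := ⟨by omega⟩
      funext t
      rw [← ZMod.natCast_zmod_val t, hsup _ (ZMod.val_lt t).le]
    · funext i d
      simp only
      rw [hdig _ i.2]
      have hlt : r - 1 - (r - 1 - (i : ℕ)) = i := by have := i.2; omega
      simp [hv, hlt]
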